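/- Let q be prime and W a channel with input alphabet ℤ/qℤ. Define Z_d(W) = (1/q) Σ_x Z(W_{{x, x+d}}) for d ≠ 0, Z_max(W) = max_{d≠0} Z_d(W), and Z(W) = (1/(q−1)) Σ_{d≠0} Z_d(W). If Z_max(W) ≥ 1 − δ for some δ > 0, then Z(W) ≥ 1 − q(q−1)²δ. -/

import Mathlib

open Finset

/-- `Z_d(W) = (1/q) ∑_x Z(W_{{x,x+d}})`. -/
noncomputable def Zd {q : ℕ} {Y : Type*} [NeZero q] [Fintype Y]
    (W : ZMod q → Y → ℝ) (d : ZMod q) : ℝ :=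
  (q : ℝ)⁻¹ * ∑ x, ∑ y, Real.sqrt (W x y * W (x + d) y)

/-- `Z_max(W) = max_{d ≠ 0} Z_d(W)`. -/
noncomputable def Zmax {q : ℕ} {Y : Type*} [NeZero q] [Fintype Y]
    (W : ZMod q → Y → ℝ) : ℝ :=
  ⨆ d : {d : ZMod q // d ≠ 0}, Zd W d.1

/-- `Z(W) = (1/(q-1)) ∑_{d ≠ 0} Z_d(W)`. -/
noncomputable def Zbar {q : ℕ} {Y : Type*} [NeZero q] [Fintype Y]
    (W : ZMod q → Y → ℝ) : ℝ :=
  ((q : ℝ) - 1)⁻¹ * ∑ d ∈ univ.filter (· ≠ (0 : ZMod q)), Zd W d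

theorem one_sub_Zd_eq {q : ℕ} {Y : Type*} [NeZero q] [Fintype Y] {W : ZMod q → Y → ℝ}
    (hnn : ∀ x y, 0 ≤ W x y) (hsum : ∀ x, ∑ y, W x y = 1) (d : ZMod q) :
    1 - Zd W d =
      (2 * (q : ℝ))⁻¹ * ∑ x, ∑ y, (Real.sqrt (W (x + d) y) - Real.sqrt (W x y)) ^ 2 := by
  have hq : (q : ℝ) ≠ 0 := Nat.cast_ne_zero.mpr (NeZero.ne q)
  have expand (x : ZMod q) : ∑ y, (Real.sqrt (W (x + d) y) - Real.sqrt (W x y)) ^ 2 =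
      2 - 2 * ∑ y, Real.sqrt (W x y * W (x + d) y) := by
    calc
      _ = ∑ y, (W (x + d) y + W x y - 2 * Real.sqrt (W x y * W (x + d) y)) := by
        refine sum_congr rfl fun y _ => ?_
        rw [Real.sqrt_mul (hnn x y), sub_sq, Real.sq_sqrt (hnn _ _), Real.sq_sqrt (hnn _ _)]
        ring
      _ = _ := by
        rw [sum_sub_distrib, sum_add_distrib, hsum, hsum, mul_sum]
        norm_num
  simp only [expand, sum_sub_distrib, ← mul_sum, sum_const, card_univ, ZMod.card, nsmul_eq_mul, Zd]
  field_simp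

theorem sq_sub_le_mul_sum_sq_sub (a : ℕ → ℝ) (n : ℕ) :
    (a n - a 0) ^ 2 ≤ n * ∑ i ∈ range n, (a (i + 1) - a i) ^ 2 := by
  rw [← sum_range_sub a n]
  simpa using sq_sum_le_card_mul_sum_sq (s := range n) (f := fun i => a (i + 1) - a i)

theorem one_sub_Zd_natCast_mul_le {q : ℕ} {Y : Type*} [NeZero q] [Fintype Y]
    {W : ZMod q → Y → ℝ} (hnn : ∀ x y, 0 ≤ W x y) (hsum : ∀ x, ∑ y, W x y = 1)
    (d : ZMod q) (n : ℕ) :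
    1 - Zd W (n * d) ≤ (n : ℝ) ^ 2 * (1 - Zd W d) := by
  rw [one_sub_Zd_eq hnn hsum, one_sub_Zd_eq hnn hsum, mul_left_comm]
  refine mul_le_mul_of_nonneg_left ?_ (by positivity)
  set f : ZMod q → ℝ := fun x => ∑ y, (Real.sqrt (W (x + d) y) - Real.sqrt (W x y)) ^ 2 with hf
  calc
    _ ≤ ∑ x, (n : ℝ) * ∑ i ∈ range n, f (x + i * d) := by
      refine sum_le_sum fun x _ => ?_
      rw [hf, sum_comm, mul_sum]
      refine sum_le_sum fun y _ => ?_
      simpa [add_mul, add_assoc] using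
        sq_sub_le_mul_sum_sq_sub (fun i => Real.sqrt (W (x + i * d) y)) n
    _ = (n : ℝ) * ∑ i ∈ range n, ∑ x, f (x + i * d) := by rw [← mul_sum, sum_comm]
    _ = (n : ℝ) ^ 2 * ∑ x, f x := by
      have shift (c : ZMod q) : ∑ x, f (x + c) = ∑ x, f x := Equiv.sum_comp (Equiv.addRight c) f
      simp only [shift, sum_const, card_range, nsmul_eq_mul]
      ring

theorem one_sub_Zd_nonneg {q : ℕ} {Y : Type*} [NeZero q] [Fintype Y] {W : ZMod q → Y → ℝ}
    (hnn : ∀ x y, 0 ≤ W x y) (hsum : ∀ x, ∑ y, W x y = 1) (d : ZMod q) : 0 ≤ 1 - Zd W d := by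
  rw [one_sub_Zd_eq hnn hsum]
  positivity

theorem one_sub_Zd_le {q : ℕ} [NeZero q] (hq : Nat.Prime q) {Y : Type*} [Fintype Y]
    {W : ZMod q → Y → ℝ} (hnn : ∀ x y, 0 ≤ W x y) (hsum : ∀ x, ∑ y, W x y = 1)
    {d : ZMod q} (hd : d ≠ 0) (e : ZMod q) :
    1 - Zd W e ≤ ((q : ℝ) - 1) ^ 2 * (1 - Zd W d) := by
  have : Fact q.Prime := ⟨hq⟩
  have he : ((e / d).val : ZMod q) * d = e := by
    rw [ZMod.natCast_zmod_val, div_mul_cancel₀ e hd]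
  have hval : ((e / d).val : ℝ) ≤ (q : ℝ) - 1 := by
    rw [le_sub_iff_add_le]
    exact_mod_cast ZMod.val_lt (e / d)
  calc
    _ ≤ ((e / d).val : ℝ) ^ 2 * (1 - Zd W d) := by
      simpa only [he] using one_sub_Zd_natCast_mul_le hnn hsum d (e / d).val
    _ ≤ _ := by
      have := one_sub_Zd_nonneg hnn hsum d
      gcongr

/-- For prime `q`: if `Z_max(W) ≥ 1 - δ` then `Z(W) ≥ 1 - q(q-1)²δ`. -/
theorem Zbar_ge_of_Zmax_ge {q : ℕ} [NeZero q] (hq : Nat.Prime q)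
    {Y : Type*} [Fintype Y] (W : ZMod q → Y → ℝ)
    (hnn : ∀ x y, 0 ≤ W x y) (hsum : ∀ x, ∑ y, W x y = 1)
    (δ : ℝ) (hδ : 0 < δ) (h : 1 - δ ≤ Zmax W) :
    1 - (q : ℝ) * ((q : ℝ) - 1) ^ 2 * δ ≤ Zbar W := by
  have hq2 : (2 : ℝ) ≤ q := mod_cast hq.two_le
  have : Fact q.Prime := ⟨hq⟩
  have : Nonempty {d : ZMod q // d ≠ 0} := ⟨⟨1, one_ne_zero⟩⟩
  obtain ⟨⟨d, hd⟩, hmax⟩ :=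
    exists_eq_ciSup_of_finite (f := fun d : {d : ZMod q // d ≠ 0} => Zd W d.1)
  have hdδ : 1 - Zd W d ≤ δ := by
    have : Zd W d = Zmax W := hmax
    linarith
  have hZ (e : ZMod q) : 1 - (q : ℝ) * ((q : ℝ) - 1) ^ 2 * δ ≤ Zd W e := by
    have h₁ := one_sub_Zd_le hq hnn hsum hd e
    have h₂ : ((q : ℝ) - 1) ^ 2 * (1 - Zd W d) ≤ ((q : ℝ) - 1) ^ 2 * δ := by gcongr
    have h₃ : 0 ≤ ((q : ℝ) - 1) * (((q : ℝ) - 1) ^ 2 * δ) :=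
      mul_nonneg (by linarith) (by positivity)
    linarith
  have hcard : (#(univ.filter (· ≠ (0 : ZMod q))) : ℝ) = (q : ℝ) - 1 := by
    rw [filter_ne', card_erase_of_mem (mem_univ _), card_univ, ZMod.card, Nat.cast_pred hq.pos]
  have hle := card_nsmul_le_sum (univ.filter (· ≠ (0 : ZMod q))) (Zd W) _ fun e _ => hZ e
  rw [nsmul_eq_mul, hcard] at hle
  rwa [Zbar, le_inv_mul_iff₀ (by linarith)]
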